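/- Let K ≥ 1, α ∈ (0,1), and a₁, …, a_K > 0. Let S₁, …, S_K be independent real random variables with S_k Gamma(2,a_k)-distributed, let J be the almost surely unique index maximizing k ↦ γ(2, a_k·S_k), and let Y be uniformly distributed on [0, α²] and independent of (S₁,…,S_K). Then E[log(1 + (S_J^{-1} + Y)^{-1})] = (1/α²)·∑_{k=1}^{K} a_k²·∫₀^∞ Υ^{MRT}(x)·[γ(2, a_k·x)]^{K-1}·x·e^{-a_k·x} dx. (This is the ergodic rate of the first user selected by the CDF-Based User Selection scheme in multi-user mode with maximum-ratio transmission, with a_k = σ²/g_k.) -/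

import Mathlib

open MeasureTheory ProbabilityTheory Real Set

/-- The Gamma(2, a) law: density `a² · x · e^{-a·x}` on `(0, ∞)` (shape 2, rate `a`). -/
noncomputable def gammaLaw (a : ℝ) : Measure ℝ :=
  volume.withDensity fun x =>
    ENNReal.ofReal (if 0 < x then a ^ 2 * x * Real.exp (-(a * x)) else 0)

/-- The uniform law on the real interval `[lo, hi]`. -/
noncomputable def unifLaw (lo hi : ℝ) : Measure ℝ :=
  (ENNReal.ofReal (hi - lo))⁻¹ • volume.restrict (Set.Icc lo hi)

/-- The lower incomplete gamma function with shape 2: `γ(2, z) = 1 - (z+1)·e^{-z}`. -/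
noncomputable def lGamma2 (z : ℝ) : ℝ := 1 - (z + 1) * Real.exp (-z)

/-- `Υ^{MRT}(x)` for orthogonality parameter `α`. -/
noncomputable def UpsMRT (α x : ℝ) : ℝ :=
  Real.log ((1 + x + α ^ 2 * x) / (1 + x))
    + (1 / x) * Real.log ((1 + (x⁻¹ + α ^ 2)⁻¹) / (1 + x))
    + α ^ 2 * Real.log (1 + (x⁻¹ + α ^ 2)⁻¹)


lemma gammaLaw_eq_gammaMeasure (a : ℝ) : gammaLaw a = gammaMeasure 2 a := by
  unfold gammaLaw gammaMeasure
  congr 1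
  ext x
  rw [gammaPDF, gammaPDFReal]
  congr 1
  rcases lt_trichotomy x 0 with hx | rfl | hx
  · simp [hx.not_gt, hx.not_ge]
  · norm_num
  · have h2 : (2 : ℝ) - 1 = 1 := by norm_num
    simp [hx, hx.le, h2]

lemma isProbabilityMeasure_gammaLaw {a : ℝ} (ha : 0 < a) : IsProbabilityMeasure (gammaLaw a) := by
  rw [gammaLaw_eq_gammaMeasure]
  exact isProbabilityMeasure_gammaMeasure two_pos ha

lemma gammaLaw_eq_withDensity_restrict (a : ℝ) :
    gammaLaw a = (volume.restrict (Ioi 0)).withDensity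
      fun x => ENNReal.ofReal (a ^ 2 * x * Real.exp (-(a * x))) := by
  rw [← withDensity_indicator measurableSet_Ioi, gammaLaw]
  congr 1
  ext x
  by_cases hx : 0 < x <;> simp [hx]

lemma ae_gammaLaw_pos (a : ℝ) : ∀ᵐ x ∂gammaLaw a, 0 < x := by
  rw [gammaLaw_eq_withDensity_restrict]
  exact (withDensity_absolutelyContinuous _ _).ae_le (ae_restrict_mem measurableSet_Ioi)

lemma integral_gammaLaw (a : ℝ) (h : ℝ → ℝ) :
    ∫ x, h x ∂gammaLaw a
      = a ^ 2 * ∫ x in Ioi (0 : ℝ), h x * x * Real.exp (-(a * x)) := by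
  rw [gammaLaw_eq_withDensity_restrict, integral_withDensity_eq_integral_toReal_smul
    (by fun_prop) (by simp), ← integral_const_mul]
  refine setIntegral_congr_fun measurableSet_Ioi fun x hx => ?_
  have hx : 0 < x := hx
  simp only [smul_eq_mul]
  rw [ENNReal.toReal_ofReal (by positivity)]
  ring

lemma integrable_id_gammaLaw {a : ℝ} (ha : 0 < a) : Integrable (fun x : ℝ => x) (gammaLaw a) := by
  rw [gammaLaw_eq_withDensity_restrict, integrable_withDensity_iff_integrable_smul'
    (by fun_prop) (by simp)]
  have h := (integrableOn_rpow_mul_exp_neg_mul_rpow (p := 1) (s := 2) (b := a)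
    (by norm_num) one_pos ha).const_mul (a ^ 2)
  refine h.congr (ae_restrict_of_forall_mem measurableSet_Ioi fun x hx => ?_)
  have hx : 0 < x := hx
  simp only [smul_eq_mul]
  rw [ENNReal.toReal_ofReal (by positivity)]
  simp
  ring

lemma hasDerivAt_lGamma2 (z : ℝ) : HasDerivAt lGamma2 (z * Real.exp (-z)) z := by
  have h := (((hasDerivAt_id z).add_const 1).mul (hasDerivAt_id z).neg.exp).const_sub 1
  refine h.congr_deriv ?_
  simp
  ring

lemma strictMonoOn_lGamma2 : StrictMonoOn lGamma2 (Ici 0) := by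
  refine strictMonoOn_of_deriv_pos (convex_Ici 0)
    (fun z _ => (hasDerivAt_lGamma2 z).continuousAt.continuousWithinAt) fun z hz => ?_
  rw [interior_Ici] at hz
  have hz : 0 < z := hz
  rw [(hasDerivAt_lGamma2 z).deriv]
  positivity

lemma gammaLaw_real_Iio {a t : ℝ} (ht : 0 ≤ t) :
    (gammaLaw a).real (Iio t) = lGamma2 (a * t) := by
  rw [← integral_indicator_one measurableSet_Iio, integral_gammaLaw, ← integral_const_mul]
  have h1 : ∀ x, a ^ 2 * ((Iio t).indicator (1 : ℝ → ℝ) x * x * Real.exp (-(a * x)))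
      = (Iio t).indicator (fun x => a * x * Real.exp (-(a * x)) * a) x := by
    intro x
    by_cases hx : x < t
    · simp [hx]; ring
    · simp [hx]
  simp_rw [h1]
  rw [integral_indicator measurableSet_Iio, Measure.restrict_restrict measurableSet_Iio,
    Iio_inter_Ioi, ← integral_Ioc_eq_integral_Ioo, ← intervalIntegral.integral_of_le ht,
    intervalIntegral.integral_eq_sub_of_hasDerivAt (f := fun x => lGamma2 (a * x))]
  · simp [lGamma2]
  · intro x _
    exact ((hasDerivAt_lGamma2 (a * x)).comp x ((hasDerivAt_id x).const_mul a)).congr_deriv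
      (by simp)
  · exact Continuous.intervalIntegrable (by fun_prop) _ _

lemma isProbabilityMeasure_unifLaw {lo hi : ℝ} (h : lo < hi) :
    IsProbabilityMeasure (unifLaw lo hi) := by
  refine ⟨?_⟩
  have h' : 0 < hi - lo := sub_pos.2 h
  simp only [unifLaw, Measure.smul_apply, Measure.restrict_apply_univ, Real.volume_Icc,
    smul_eq_mul]
  exact ENNReal.inv_mul_cancel (by simpa using h) ENNReal.ofReal_ne_top

lemma ae_unifLaw_mem_Icc (lo hi : ℝ) : ∀ᵐ y ∂unifLaw lo hi, y ∈ Icc lo hi :=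
  Measure.ae_smul_measure (ae_restrict_mem measurableSet_Icc) _

lemma integral_log_unifLaw {α x : ℝ} (hα : 0 < α) (hx : 0 < x) :
    ∫ y, Real.log (1 + (x⁻¹ + y)⁻¹) ∂unifLaw 0 (α ^ 2) = 1 / α ^ 2 * UpsMRT α x := by
  have hα2 : 0 < α ^ 2 := by positivity
  have hc : 0 < x⁻¹ := by positivity
  have hpos : ∀ y ∈ uIcc 0 (α ^ 2), 0 < x⁻¹ + y := fun y hy => by
    rw [uIcc_of_le hα2.le] at hy
    linarith [hy.1]
  rw [unifLaw, integral_smul_measure, integral_Icc_eq_integral_Ioc,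
    ← intervalIntegral.integral_of_le hα2.le,
    intervalIntegral.integral_eq_sub_of_hasDerivAt (f := fun y =>
      (x⁻¹ + y + 1) * Real.log (x⁻¹ + y + 1) - (x⁻¹ + y) * Real.log (x⁻¹ + y))]
  · have hx1 : 1 + x = (x⁻¹ + 1) / x⁻¹ := by field_simp
    have hd : 1 + (x⁻¹ + α ^ 2)⁻¹ = (x⁻¹ + α ^ 2 + 1) / (x⁻¹ + α ^ 2) := by field_simp
    have hxa : (1 + x + α ^ 2 * x) / (1 + x) = (x⁻¹ + α ^ 2 + 1) / (x⁻¹ + 1) := by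
      field_simp; ring
    rw [UpsMRT, hxa, hd, hx1]
    rw [Real.log_div (by positivity) (by positivity), Real.log_div (by positivity) (by positivity),
      Real.log_div (by positivity) (by positivity), Real.log_div (by positivity) (by positivity)]
    simp only [sub_zero, ENNReal.toReal_inv, ENNReal.toReal_ofReal hα2.le, smul_eq_mul, add_zero,
      one_div]
    ring
  · intro y hy
    have h0 := hpos y hy
    have hl := (hasDerivAt_id y).const_add x⁻¹
    have h1 := (Real.hasDerivAt_mul_log (x := x⁻¹ + y + 1) (by positivity)).comp y (hl.add_const 1)
    have h2 := (Real.hasDerivAt_mul_log (x := x⁻¹ + y) h0.ne').comp y hl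
    refine (h1.sub h2).congr_deriv ?_
    rw [show 1 + (x⁻¹ + y)⁻¹ = (x⁻¹ + y + 1) / (x⁻¹ + y) by rw [add_div, div_self h0.ne', one_div],
      Real.log_div (by positivity) h0.ne']
    ring
  · refine ContinuousOn.intervalIntegrable fun y hy => ContinuousAt.continuousWithinAt ?_
    have h0 := hpos y hy
    have h1 : 1 + (x⁻¹ + y)⁻¹ ≠ 0 := by positivity
    fun_prop (disch := first | assumption | exact h0.ne')

/-- Scaled coordinate `k` strictly dominates all the others. -/
def dominanceSet {n : ℕ} (a : Fin (n + 1) → ℝ) (k : Fin (n + 1)) : Set (Fin (n + 1) → ℝ) :=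
  {s | ∀ j, j ≠ k → a j * s j < a k * s k}

lemma measurableSet_dominanceSet {n : ℕ} (a : Fin (n + 1) → ℝ) (k : Fin (n + 1)) :
    MeasurableSet (dominanceSet a k) := by
  simp only [dominanceSet, ofPred_forall]
  exact MeasurableSet.iInter fun j => MeasurableSet.iInter fun _ =>
    measurableSet_lt (by fun_prop) (by fun_prop)

lemma integral_pi_gammaLaw_dominanceSet {n : ℕ} {a : Fin (n + 1) → ℝ} (ha : ∀ k, 0 < a k)
    (k : Fin (n + 1)) {G : ℝ → ℝ} (hG : Integrable G (gammaLaw (a k))) :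
    ∫ s, (dominanceSet a k).indicator (fun s => G (s k)) s ∂Measure.pi (fun k => gammaLaw (a k))
      = a k ^ 2 * ∫ x in Ioi (0 : ℝ),
          G x * lGamma2 (a k * x) ^ n * x * Real.exp (-(a k * x)) := by
  have hprob : ∀ k, IsProbabilityMeasure (gammaLaw (a k)) :=
    fun k => isProbabilityMeasure_gammaLaw (ha k)
  have hmp := measurePreserving_piFinSuccAbove (fun k => gammaLaw (a k)) k
  set T : Set (ℝ × (Fin n → ℝ)) := {p | ∀ j, a (k.succAbove j) * p.2 j < a k * p.1} with hT
  have hTm : MeasurableSet T := by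
    simp only [hT, ofPred_forall]
    exact MeasurableSet.iInter fun j => measurableSet_lt (by fun_prop) (by fun_prop)
  have hcomp : ∀ s, (dominanceSet a k).indicator (fun s => G (s k)) s
      = T.indicator (fun p => G p.1)
          (MeasurableEquiv.piFinSuccAbove (fun _ : Fin (n + 1) => ℝ) k s) := by
    intro s
    have : s ∈ dominanceSet a k
        ↔ MeasurableEquiv.piFinSuccAbove (fun _ : Fin (n + 1) => ℝ) k s ∈ T := by
      constructor
      · intro h j
        exact h _ (Fin.succAbove_ne k j)
      · intro h j hj
        obtain ⟨i, rfl⟩ := Fin.exists_succAbove_eq hj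
        exact h i
    by_cases h : s ∈ dominanceSet a k
    · rw [indicator_of_mem h, indicator_of_mem (this.1 h)]
      rfl
    · rw [indicator_of_notMem h, indicator_of_notMem (this.not.1 h)]
  simp_rw [hcomp]
  rw [hmp.integral_comp' (g := T.indicator fun p => G p.1), integral_prod _
    ((hG.comp_fst _).indicator hTm), ← integral_gammaLaw (a k) fun x => G x * lGamma2 (a k * x) ^ n]
  refine integral_congr_ae ?_
  filter_upwards [ae_gammaLaw_pos (a k)] with x hx
  have hset : ∀ s : Fin n → ℝ, T.indicator (fun p => G p.1) (x, s)
      = (univ.pi fun j => Iio (a k * x / a (k.succAbove j))).indicator (fun _ => G x) s := by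
    intro s
    have : (x, s) ∈ T ↔ s ∈ univ.pi fun j => Iio (a k * x / a (k.succAbove j)) := by
      simp [hT, lt_div_iff₀ (ha _), mul_comm]
    by_cases h : (x, s) ∈ T
    · rw [indicator_of_mem h, indicator_of_mem (this.1 h)]
    · rw [indicator_of_notMem h, indicator_of_notMem (this.not.1 h)]
  simp_rw [hset]
  rw [integral_indicator_const _ (MeasurableSet.univ_pi fun _ => measurableSet_Iio),
    Measure.real, Measure.pi_pi, ENNReal.toReal_prod, smul_eq_mul, mul_comm]
  congr 1
  have : ∀ j : Fin n, (gammaLaw (a (k.succAbove j)) (Iio (a k * x / a (k.succAbove j)))).toReal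
      = lGamma2 (a k * x) := by
    intro j
    have hj := ha (k.succAbove j)
    have hk := ha k
    refine (gammaLaw_real_Iio (by positivity)).trans ?_
    congr 1
    field_simp
  simp [this]

/-- Ergodic rate of the first user selected by the CDF-based selection
scheme in multi-user mode with maximum-ratio transmission: `S₁, …, S_K` independent with
`S_k ~ Gamma(2, a_k)`, `Y ~ Uniform[0, α²]` independent of the `S_k` (joint law the
product of the marginals), and `J ω` is almost surely the unique index maximizing
`k ↦ γ(2, a_k·S_k ω)` (every other index gives a strictly smaller value). Then
`E[log(1 + (S_J⁻¹ + Y)⁻¹)]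
  = (1/α²)·∑_k a_k²·∫₀^∞ Υ^{MRT}(x)·[γ(2, a_k·x)]^{K-1}·x·e^{-a_k·x} dx`. -/
theorem cus_mu_mode_mrt_first_user_rate {Ω : Type*} [MeasurableSpace Ω]
    (μ : Measure Ω) [IsProbabilityMeasure μ]
    (K : ℕ) (hK : 1 ≤ K) (α : ℝ) (hα : α ∈ Set.Ioo (0 : ℝ) 1)
    (a : Fin K → ℝ) (ha : ∀ k, 0 < a k)
    (S : Fin K → Ω → ℝ) (Y : Ω → ℝ)
    (hSmeas : ∀ k, Measurable (S k)) (hYmeas : Measurable Y)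
    (hlaw : Measure.map (fun ω => ((fun k => S k ω, Y ω) : (Fin K → ℝ) × ℝ)) μ
      = (Measure.pi fun k => gammaLaw (a k)).prod (unifLaw 0 (α ^ 2)))
    (J : Ω → Fin K)
    (hJ : ∀ᵐ ω ∂μ, ∀ k, k ≠ J ω →
      lGamma2 (a k * S k ω) < lGamma2 (a (J ω) * S (J ω) ω)) :
    ∫ ω, Real.log (1 + ((S (J ω) ω)⁻¹ + Y ω)⁻¹) ∂μ
      = (1 / α ^ 2) * ∑ k : Fin K, (a k) ^ 2 *
          ∫ x in Set.Ioi (0 : ℝ),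
            UpsMRT α x * (lGamma2 (a k * x)) ^ (K - 1) * x * Real.exp (-(a k * x)) := by
  obtain ⟨n, rfl⟩ : ∃ n, K = n + 1 := ⟨K - 1, by omega⟩
  have hα0 : 0 < α := hα.1
  have hprob : ∀ k, IsProbabilityMeasure (gammaLaw (a k)) :=
    fun k => isProbabilityMeasure_gammaLaw (ha k)
  have hunif : IsProbabilityMeasure (unifLaw 0 (α ^ 2)) :=
    isProbabilityMeasure_unifLaw (by positivity)
  have hmp : MeasurePreserving (fun ω => ((fun k => S k ω, Y ω) : (Fin (n + 1) → ℝ) × ℝ)) μ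
      ((Measure.pi fun k => gammaLaw (a k)).prod (unifLaw 0 (α ^ 2))) :=
    ⟨by fun_prop, hlaw⟩
  have hmpS : ∀ k, MeasurePreserving (S k) μ (gammaLaw (a k)) := fun k =>
    (measurePreserving_eval (fun k => gammaLaw (a k)) k).comp (measurePreserving_fst.comp hmp)
  have hSpos : ∀ᵐ ω ∂μ, ∀ k, 0 < S k ω :=
    ae_all_iff.2 fun k => (hmpS k).quasiMeasurePreserving.ae (ae_gammaLaw_pos (a k))
  set f : ℝ × ℝ → ℝ := fun p => Real.log (1 + (p.1⁻¹ + p.2)⁻¹) with hf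
  have hfm : Measurable f := by fun_prop
  have hfint : ∀ k, Integrable f ((gammaLaw (a k)).prod (unifLaw 0 (α ^ 2))) := by
    intro k
    refine ((integrable_id_gammaLaw (ha k)).comp_fst (unifLaw 0 (α ^ 2))).mono'
      hfm.aestronglyMeasurable ?_
    have h1 := measurePreserving_fst (μ := gammaLaw (a k)) (ν := unifLaw 0 (α ^ 2))
      |>.quasiMeasurePreserving.ae (ae_gammaLaw_pos (a k))
    have h2 := measurePreserving_snd (μ := gammaLaw (a k)) (ν := unifLaw 0 (α ^ 2))
      |>.quasiMeasurePreserving.ae (ae_unifLaw_mem_Icc 0 (α ^ 2))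
    filter_upwards [h1, h2] with p hp hy
    have hy0 : 0 ≤ p.2 := hy.1
    have hinv : (p.1⁻¹ + p.2)⁻¹ ≤ p.1 := inv_le_of_inv_le₀ hp (by linarith)
    have hnn : 0 ≤ (p.1⁻¹ + p.2)⁻¹ := by positivity
    rw [Real.norm_of_nonneg (Real.log_nonneg (by linarith))]
    have := Real.log_le_sub_one_of_pos (x := 1 + (p.1⁻¹ + p.2)⁻¹) (by positivity)
    linarith
  have hmpk : ∀ k, MeasurePreserving (fun p : (Fin (n + 1) → ℝ) × ℝ => (p.1 k, p.2))
      ((Measure.pi fun k => gammaLaw (a k)).prod (unifLaw 0 (α ^ 2)))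
      ((gammaLaw (a k)).prod (unifLaw 0 (α ^ 2))) := fun k =>
    (measurePreserving_eval (fun k => gammaLaw (a k)) k).prod (MeasurePreserving.id _)
  set φ : Fin (n + 1) → (Fin (n + 1) → ℝ) × ℝ → ℝ := fun k =>
    (dominanceSet a k ×ˢ univ).indicator fun p => f (p.1 k, p.2) with hφ
  have hφint : ∀ k, Integrable (φ k)
      ((Measure.pi fun k => gammaLaw (a k)).prod (unifLaw 0 (α ^ 2))) := fun k =>
    (((hmpk k).integrable_comp hfm.aestronglyMeasurable).2 (hfint k)).indicator
      ((measurableSet_dominanceSet a k).prod MeasurableSet.univ)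
  have hsum : (fun ω => Real.log (1 + ((S (J ω) ω)⁻¹ + Y ω)⁻¹))
      =ᵐ[μ] fun ω => ∑ k, φ k (fun k => S k ω, Y ω) := by
    filter_upwards [hJ, hSpos] with ω hω hpos
    have hdom : ∀ j, j ≠ J ω → a j * S j ω < a (J ω) * S (J ω) ω := fun j hj =>
      (strictMonoOn_lGamma2.lt_iff_lt (mul_pos (ha _) (hpos _)).le
        (mul_pos (ha _) (hpos _)).le).1 (hω j hj)
    rw [Finset.sum_eq_single (J ω)]
    · have hmem : ((fun k => S k ω, Y ω) : (Fin (n + 1) → ℝ) × ℝ)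
          ∈ dominanceSet a (J ω) ×ˢ univ := mk_mem_prod hdom (mem_univ _)
      simp only [hφ, indicator_of_mem hmem, hf]
    · intro k _ hk
      refine indicator_of_notMem (fun h => ?_) _
      exact lt_asymm (hdom k hk) (h.1 (J ω) hk.symm)
    · simp
  have hφω : ∀ k, Integrable (fun ω => φ k (fun k => S k ω, Y ω)) μ := fun k =>
    (hmp.integrable_comp (hφint k).aestronglyMeasurable).2 (hφint k)
  rw [integral_congr_ae hsum, integral_finsetSum _ fun k _ => hφω k, Finset.mul_sum]
  refine Finset.sum_congr rfl fun k _ => ?_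
  have hpush : ∫ ω, φ k (fun k => S k ω, Y ω) ∂μ
      = ∫ p, φ k p ∂((Measure.pi fun k => gammaLaw (a k)).prod (unifLaw 0 (α ^ 2))) := by
    rw [← hlaw]
    refine (integral_map hmp.measurable.aemeasurable ?_).symm
    rw [hlaw]
    exact (hφint k).aestronglyMeasurable
  have hinner : ∀ s, ∫ y, φ k (s, y) ∂unifLaw 0 (α ^ 2)
      = (dominanceSet a k).indicator
          (fun s => (fun x => ∫ y, f (x, y) ∂unifLaw 0 (α ^ 2)) (s k)) s := by
    intro s
    by_cases h : s ∈ dominanceSet a k <;> simp [hφ, h, indicator]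
  rw [hpush, integral_prod _ (hφint k)]
  simp_rw [hinner]
  rw [integral_pi_gammaLaw_dominanceSet ha k (hfint k).integral_prod_left, mul_left_comm]
  congr 1
  rw [← integral_const_mul]
  refine setIntegral_congr_fun measurableSet_Ioi fun x hx => ?_
  simp only [hf, integral_log_unifLaw hα0 hx, Nat.add_sub_cancel]
  ring
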